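/- arXiv:1802.06895 — 4 statements merged into one kernel-verified Lean document; each statement's English description precedes it below -/
import Mathlib

section
/- Let P be a type of propositional fluents and A a type of action labels. For every labeled transition system T on (Set P) × A × (Set P) and all sets Λ₁, Λ₂ ⊆ P, the projection abstractions compose according to [[T]_{Λ₂}]_{Λ₁} = [T]_{Λ₁ ∪ Λ₂} (where states of the iterated abstraction are identified with subsets of P in the obvious way). In particular, projection abstraction is commutative ([[T]_{Λ₁}]_{Λ₂} = [[T]_{Λ₂}]_{Λ₁}) and idempotent ([[T]_{Λ₁}]_{Λ₁} = [T]_{Λ₁}). -/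
/-- Projection abstraction of a labeled transition system on states `Set P`
with action labels `A`, with respect to a set `Λ` of propositions. -/
def AbsT {P A : Type*} (T : Set P → A → Set P → Prop) (Λ : Set P) :
    Set P → A → Set P → Prop :=
  fun s₁ a s₂ => ∃ t₁ t₂, T t₁ a t₂ ∧ s₁ = t₁ \ Λ ∧ s₂ = t₂ \ Λ

/-- Abstracting away `Λ₂` and then `Λ₁` is abstracting away their union. -/
theorem absT_absT {P A : Type*} (T : Set P → A → Set P → Prop) (Λ₁ Λ₂ : Set P) :
    AbsT (AbsT T Λ₂) Λ₁ = AbsT T (Λ₁ ∪ Λ₂) := by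
  funext s₁ a s₂
  apply propext
  constructor
  · rintro ⟨_, _, ⟨t₁, t₂, h, rfl, rfl⟩, rfl, rfl⟩
    exact ⟨t₁, t₂, h, by rw [Set.sdiff_sdiff, Set.union_comm], by rw [Set.sdiff_sdiff, Set.union_comm]⟩
  · rintro ⟨t₁, t₂, h, rfl, rfl⟩
    exact ⟨_, _, ⟨t₁, t₂, h, rfl, rfl⟩,
      by rw [Set.sdiff_sdiff, Set.union_comm], by rw [Set.sdiff_sdiff, Set.union_comm]⟩

/-- Projection abstractions compose (`[[T]_{Λ₂}]_{Λ₁} = [T]_{Λ₁ ∪ Λ₂}`);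
in particular they are commutative and idempotent. -/
theorem abs_comp_comm_idem {P A : Type*} (T : Set P → A → Set P → Prop)
    (Λ₁ Λ₂ : Set P) :
    AbsT (AbsT T Λ₂) Λ₁ = AbsT T (Λ₁ ∪ Λ₂) ∧
    AbsT (AbsT T Λ₁) Λ₂ = AbsT (AbsT T Λ₂) Λ₁ ∧
    AbsT (AbsT T Λ₁) Λ₁ = AbsT T Λ₁ := by
  refine ⟨absT_absT T Λ₁ Λ₂, ?_, ?_⟩
  · rw [absT_absT, absT_absT, Set.union_comm]
  · rw [absT_absT, Set.union_self]
end

section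
/- More abstract models are logically weaker: for every labeled transition system T on (Set P) × A × (Set P), all sets Λ₁ ⊆ Λ₂ ⊆ P, every initial state I ⊆ P, goal G ⊆ P, and every plan π, if π is valid in the task abstracted by Λ₁ (i.e. valid for [T]_{Λ₁} with initial state I \ Λ₁ and goal G \ Λ₁), then π is valid in the task abstracted by Λ₂ (i.e. valid for [T]_{Λ₂} with initial state I \ Λ₂ and goal G \ Λ₂). -/
/-- A plan (list of action labels) is valid for transition system `T`, initial
state `I` and goal `G` iff following transitions of `T` along the plan from `I`
can reach a state containing `G`. -/
def ValidPlan {P A : Type*} (T : Set P → A → Set P → Prop) (I G : Set P) :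
    List A → Prop
  | [] => G ⊆ I
  | a :: π => ∃ s, T I a s ∧ ValidPlan T s G π

theorem Set.sdiff_sdiff_of_subset {P : Type*} {Λ₁ Λ₂ : Set P} (hΛ : Λ₁ ⊆ Λ₂) (s : Set P) :
    (s \ Λ₁) \ Λ₂ = s \ Λ₂ := by
  rw [Set.sdiff_sdiff, Set.union_eq_self_of_subset_left hΛ]

theorem AbsT.sdiff {P A : Type*} {T : Set P → A → Set P → Prop} {Λ₁ Λ₂ : Set P}
    (hΛ : Λ₁ ⊆ Λ₂) {s₁ s₂ : Set P} {a : A} (h : AbsT T Λ₁ s₁ a s₂) :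
    AbsT T Λ₂ (s₁ \ Λ₂) a (s₂ \ Λ₂) := by
  obtain ⟨t₁, t₂, ht, rfl, rfl⟩ := h
  exact ⟨t₁, t₂, ht, Set.sdiff_sdiff_of_subset hΛ t₁, Set.sdiff_sdiff_of_subset hΛ t₂⟩

/-- A map of states that preserves transitions and inclusions preserves valid plans. -/
theorem ValidPlan.map {P Q A : Type*} {T : Set P → A → Set P → Prop}
    {U : Set Q → A → Set Q → Prop} {f : Set P → Set Q} (hf : Monotone f)
    (hTU : ∀ s₁ a s₂, T s₁ a s₂ → U (f s₁) a (f s₂)) {I G : Set P} {π : List A}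
    (h : ValidPlan T I G π) : ValidPlan U (f I) (f G) π := by
  induction π generalizing I with
  | nil => exact hf h
  | cons a π ih =>
    obtain ⟨s, hs, h⟩ := h
    exact ⟨f s, hTU _ _ _ hs, ih h⟩

/-- More abstract models are logically weaker: if `Λ₁ ⊆ Λ₂` then every plan
valid in the task abstracted by `Λ₁` is also valid in the task abstracted
by `Λ₂`. -/
theorem abstract_weaker {P A : Type*} (T : Set P → A → Set P → Prop)
    (Λ₁ Λ₂ I G : Set P) (π : List A) (hΛ : Λ₁ ⊆ Λ₂)
    (h : ValidPlan (AbsT T Λ₁) (I \ Λ₁) (G \ Λ₁) π) :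
    ValidPlan (AbsT T Λ₂) (I \ Λ₂) (G \ Λ₂) π := by
  have h₂ := h.map (f := (· \ Λ₂)) (fun _ _ hs => Set.sdiff_subset_sdiff_left hs)
    (fun _ _ _ => AbsT.sdiff hΛ)
  simpa only [Set.sdiff_sdiff_of_subset hΛ] using h₂
end

section
/- (Proposition 1 of the paper.) Let Λ_H ⊆ Λ_i ⊆ 𝕡 be two abstraction sets, so that the abstract model at Λ_i is an abstraction of the abstract model at Λ_H. If E ⊆ 𝕡 is a valid explanation for the abstract model at Λ_i and foil set F (i.e. no plan in F is valid in the task abstracted by Λ_i \ E), then E is also a valid explanation for the abstract model at Λ_H and F (i.e. no plan in F is valid in the task abstracted by Λ_H \ E). -/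
/-- For a base task `(T, I, G)`, a set `E` of propositions is a valid
explanation for the abstract model at `Λ` and foil set `F` iff no foil in `F`
is valid in the task abstracted by `Λ \ E`. -/
def ValidExpl {P A : Type*} (T : Set P → A → Set P → Prop) (I G : Set P)
    (F : Set (List A)) (Λ E : Set P) : Prop :=
  ∀ π ∈ F, ¬ ValidPlan (AbsT T (Λ \ E)) (I \ (Λ \ E)) (G \ (Λ \ E)) π

/-- Every transition of an abstraction projects to one of any coarser abstraction. -/
theorem AbsT.mono {P A : Type*} {T : Set P → A → Set P → Prop} {Λ Λ' : Set P}
    (hΛ : Λ ⊆ Λ') {s₁ s₂ : Set P} {a : A} (h : AbsT T Λ s₁ a s₂) :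
    AbsT T Λ' (s₁ \ Λ') a (s₂ \ Λ') := by
  obtain ⟨t₁, t₂, ht, rfl, rfl⟩ := h
  exact ⟨t₁, t₂, ht, by rw [Set.sdiff_sdiff, Set.union_eq_self_of_subset_left hΛ],
    by rw [Set.sdiff_sdiff, Set.union_eq_self_of_subset_left hΛ]⟩

/-- A plan valid in an abstraction stays valid in every coarser abstraction. -/
theorem ValidPlan.mono {P A : Type*} {T : Set P → A → Set P → Prop} {Λ Λ' : Set P}
    (hΛ : Λ ⊆ Λ') {G : Set P} {π : List A} {s : Set P}
    (h : ValidPlan (AbsT T Λ) s G π) :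
    ValidPlan (AbsT T Λ') (s \ Λ') (G \ Λ') π := by
  induction π generalizing s with
  | nil => exact Set.sdiff_subset_sdiff_left h
  | cons a π ih =>
    obtain ⟨s', hs, hπ⟩ := h
    exact ⟨s' \ Λ', hs.mono hΛ, ih hπ⟩

/-- Proposition 1: if `Λ_H ⊆ Λ_i ⊆ 𝕡` and `E ⊆ 𝕡` is a valid explanation for
the abstract model at `Λ_i` and foil set `F`, then `E` is also a valid
explanation for the abstract model at `Λ_H` and `F`. -/
theorem explanation_of_abstraction {P A : Type*} (T : Set P → A → Set P → Prop)
    (I G 𝕡 : Set P) (F : Set (List A)) (ΛH Λi E : Set P)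
    (hHi : ΛH ⊆ Λi) (hi : Λi ⊆ 𝕡) (hE : E ⊆ 𝕡)
    (h : ValidExpl T I G F Λi E) :
    ValidExpl T I G F ΛH E := by
  have hsub : ΛH \ E ⊆ Λi \ E := Set.sdiff_subset_sdiff_left hHi
  intro π hπ hv
  apply h π hπ
  simpa only [Set.sdiff_sdiff, Set.union_eq_self_of_subset_left hsub] using hv.mono hsub
end

section
/- (Theorem 2 of the paper, reduced via Proposition 5 to its set-cover core.) Let U be a finite nonempty set, let S₁, …, Sₘ ⊆ U be a finite family of subsets whose union is U, and let each subset Sᵢ have a positive real cost cᵢ. Let C be the set of indices output by the greedy procedure that maintains a set R of uncovered elements (initially R = U) and, while R ≠ ∅, selects an index i with Sᵢ ∩ R ≠ ∅ minimizing cᵢ / |Sᵢ ∩ R|, adds i to its output, and replaces R by R \ Sᵢ. Then for every cover C* (i.e. every set of indices with ⋃_{i ∈ C*} Sᵢ = U), the cost of the greedy output satisfies ∑_{i ∈ C} cᵢ ≤ H_k · ∑_{i ∈ C*} cᵢ, where k = max_i |Sᵢ| and H_k = ∑_{j=1}^{k} 1/j is the k-th harmonic number. -/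
/-- One run of the greedy weighted set-cover procedure with fuel `n`,
maintaining the set `R` of uncovered elements: while some subset `S i`
intersects `R`, it selects an index `i` with `S i ∩ R ≠ ∅` minimizing
`c i / |S i ∩ R|`, adds `i` to the output and replaces `R` by `R \ S i`. -/
noncomputable def greedyCover {α : Type*} [DecidableEq α] {m : ℕ}
    (S : Fin m → Finset α) (c : Fin m → ℝ) : ℕ → Finset α → Finset (Fin m)
  | 0, _ => ∅
  | n + 1, R =>
    if h : (Finset.univ.filter fun i => ((S i) ∩ R).Nonempty).Nonempty then
      let i := Classical.choose
        (Finset.exists_min_image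
          (Finset.univ.filter fun i => ((S i) ∩ R).Nonempty)
          (fun i => c i / (((S i) ∩ R).card : ℝ)) h)
      insert i (greedyCover S c n (R \ S i))
    else ∅

/-- The partial sum `∑ 1 / (j + 1)` grows by at least `d / (b + d)` between `b` and `b + d`. -/
theorem sum_range_one_div_add_le (b d : ℕ) :
    ∑ j ∈ Finset.range b, (1 : ℝ) / (j + 1) + d / ((b + d : ℕ) : ℝ) ≤
      ∑ j ∈ Finset.range (b + d), (1 : ℝ) / (j + 1) := by
  rw [Finset.sum_range_add]
  gcongr
  have h : ∀ x ∈ Finset.range d, 1 / ((b + d : ℕ) : ℝ) ≤ 1 / (((b + x : ℕ) : ℝ) + 1) := by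
    intro x hx
    have hx' : b + x + 1 ≤ b + d := by
      have := Finset.mem_range.mp hx
      lia
    apply one_div_le_one_div_of_le (by positivity)
    exact_mod_cast hx'
  simpa [div_eq_mul_inv] using Finset.card_nsmul_le_sum _ _ _ h

/-- If `i₀` has minimal cost per new element, the part of its price charged to the elements of
`S i` is paid for by the drop of the harmonic sum attached to `S i`. -/
theorem card_mul_ratio_le_harmonic_drop {α : Type*} [DecidableEq α] (A T R : Finset α)
    {γ ρ : ℝ} (hγ : 0 ≤ γ) (hρ : (A ∩ R).Nonempty → ρ ≤ γ / ((A ∩ R).card : ℝ)) :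
    ((A ∩ R ∩ T).card : ℝ) * ρ +
        γ * ∑ j ∈ Finset.range (A ∩ (R \ T)).card, (1 : ℝ) / (j + 1) ≤
      γ * ∑ j ∈ Finset.range (A ∩ R).card, (1 : ℝ) / (j + 1) := by
  have hcard : (A ∩ R).card = (A ∩ (R \ T)).card + (A ∩ R ∩ T).card := by
    rw [← Finset.inter_sdiff_assoc, Finset.card_sdiff_add_card_inter]
  have hprice : ((A ∩ R ∩ T).card : ℝ) * ρ ≤
      γ * (((A ∩ R ∩ T).card : ℝ) / ((A ∩ R).card : ℝ)) := by
    rcases (A ∩ R).eq_empty_or_nonempty with h | h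
    · simp [h]
    · calc ((A ∩ R ∩ T).card : ℝ) * ρ
          ≤ ((A ∩ R ∩ T).card : ℝ) * (γ / ((A ∩ R).card : ℝ)) := by
            gcongr
            exact hρ h
        _ = _ := by ring
  have hsum := mul_le_mul_of_nonneg_left
    (sum_range_one_div_add_le (A ∩ (R \ T)).card (A ∩ R ∩ T).card) hγ
  rw [← hcard, mul_add] at hsum
  linarith

/-- The greedy output started from `R` costs at most the harmonically weighted cost of any
family covering `R`. -/
theorem sum_greedyCover_le {α : Type*} [DecidableEq α] {m : ℕ}
    (S : Fin m → Finset α) (c : Fin m → ℝ) (hc : ∀ i, 0 < c i)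
    (C : Finset (Fin m)) (n : ℕ) (R : Finset α) (hR : R ⊆ C.biUnion S) :
    ∑ i ∈ greedyCover S c n R, c i ≤
      ∑ i ∈ C, c i * ∑ j ∈ Finset.range (S i ∩ R).card, (1 : ℝ) / (j + 1) := by
  have hnonneg (R : Finset α) :
      0 ≤ ∑ i ∈ C, c i * ∑ j ∈ Finset.range (S i ∩ R).card, (1 : ℝ) / (j + 1) :=
    Finset.sum_nonneg fun i _ =>
      mul_nonneg (hc i).le (Finset.sum_nonneg fun j _ => by positivity)
  induction n generalizing R with
  | zero => simpa [greedyCover] using hnonneg R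
  | succ n ih =>
    rw [greedyCover]
    split_ifs with h
    · have hspec := Classical.choose_spec (Finset.exists_min_image
        (Finset.univ.filter fun i => ((S i) ∩ R).Nonempty)
        (fun i => c i / (((S i) ∩ R).card : ℝ)) h)
      generalize Classical.choose (Finset.exists_min_image
        (Finset.univ.filter fun i => ((S i) ∩ R).Nonempty)
        (fun i => c i / (((S i) ∩ R).card : ℝ)) h) = i₀ at hspec ⊢
      obtain ⟨hi₀, hmin⟩ := hspec
      simp only [Finset.mem_filter, Finset.mem_univ, true_and] at hi₀ hmin
      set ρ := c i₀ / ((S i₀ ∩ R).card : ℝ) with hρ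
      have hpos : (0 : ℝ) < (S i₀ ∩ R).card := by exact_mod_cast hi₀.card_pos
      have hρ_nonneg : 0 ≤ ρ := div_nonneg (hc i₀).le hpos.le
      have hcount : ((S i₀ ∩ R).card : ℝ) ≤ ∑ i ∈ C, ((S i ∩ R ∩ S i₀).card : ℝ) := by
        have hsubset : S i₀ ∩ R ⊆ C.biUnion fun i => S i ∩ R ∩ S i₀ := by
          intro x hx
          obtain ⟨hxS, hxR⟩ := Finset.mem_inter.mp hx
          obtain ⟨i, hi, hxi⟩ := Finset.mem_biUnion.mp (hR hxR)
          simp only [Finset.mem_biUnion, Finset.mem_inter]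
          exact ⟨i, hi, ⟨hxi, hxR⟩, hxS⟩
        exact_mod_cast (Finset.card_le_card hsubset).trans Finset.card_biUnion_le
      have hinsert : ∑ i ∈ insert i₀ (greedyCover S c n (R \ S i₀)), c i ≤
          c i₀ + ∑ i ∈ greedyCover S c n (R \ S i₀), c i := by
        by_cases hmem : i₀ ∈ greedyCover S c n (R \ S i₀)
        · rw [Finset.insert_eq_of_mem hmem]
          linarith [hc i₀]
        · rw [Finset.sum_insert hmem]
      calc ∑ i ∈ insert i₀ (greedyCover S c n (R \ S i₀)), c i
          ≤ c i₀ + ∑ i ∈ greedyCover S c n (R \ S i₀), c i := hinsert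
        _ ≤ (∑ i ∈ C, ((S i ∩ R ∩ S i₀).card : ℝ)) * ρ + ∑ i ∈ C, c i *
              ∑ j ∈ Finset.range (S i ∩ (R \ S i₀)).card, (1 : ℝ) / (j + 1) := by
            refine add_le_add ?_ (ih _ (Finset.sdiff_subset.trans hR))
            calc c i₀ = ((S i₀ ∩ R).card : ℝ) * ρ := by
                  rw [hρ, mul_div_cancel₀ _ hpos.ne']
              _ ≤ _ := mul_le_mul_of_nonneg_right hcount hρ_nonneg
        _ ≤ _ := by
            rw [Finset.sum_mul, ← Finset.sum_add_distrib]
            exact Finset.sum_le_sum fun i _ =>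
              card_mul_ratio_le_harmonic_drop (S i) (S i₀) R (hc i).le (hmin i)
    · simpa using hnonneg R

/-- Theorem 2 (set-cover core): on a weighted set-cover instance with nonempty
finite universe `U`, subsets `S i ⊆ U` whose union is `U`, and positive costs,
the greedy output `C = greedyCover S c |U| U` has cost at most `H_k` times
the cost of any cover `C*`, where `k = max_i |S i|` and
`H_k = ∑_{j=1}^{k} 1/j` is the `k`-th harmonic number. -/
theorem greedyCover_harmonic_approx {α : Type*} [DecidableEq α] {m : ℕ}
    (U : Finset α) (hU : U.Nonempty) (S : Fin m → Finset α) (c : Fin m → ℝ)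
    (hsub : ∀ i, S i ⊆ U) (hcover : Finset.univ.biUnion S = U)
    (hc : ∀ i, 0 < c i) :
    ∀ Cstar : Finset (Fin m), Cstar.biUnion S = U →
      ∑ i ∈ greedyCover S c U.card U, c i ≤
        (∑ j ∈ Finset.range (Finset.univ.sup fun i => (S i).card),
            (1 : ℝ) / (j + 1)) * ∑ i ∈ Cstar, c i := by
  intro Cstar hCstar
  refine (sum_greedyCover_le S c hc Cstar U.card U hCstar.ge).trans ?_
  rw [Finset.mul_sum]
  refine Finset.sum_le_sum fun i _ => ?_
  rw [mul_comm]
  refine mul_le_mul_of_nonneg_right ?_ (hc i).le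
  refine Finset.sum_le_sum_of_subset_of_nonneg (Finset.range_subset_range.mpr ?_)
    fun j _ _ => by positivity
  exact (Finset.card_le_card Finset.inter_subset_left).trans
    (Finset.le_sup (f := fun i => (S i).card) (Finset.mem_univ i))
end
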